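/- arXiv:2210.04376 — 2 statements merged into one kernel-verified Lean document; each statement's English description precedes it below -/
import Mathlib

section
/- Let v be a bounded, positive solution of the ODE (O6) such that v(t) → 0 as t → +∞ and as t → -∞. Then there exists T ∈ ℝ such that v(t) = (cosh(t - T))^{-(n-6)/2} for all t ∈ ℝ. -/
noncomputable section

open Real

def cN (n : ℕ) : ℝ := (n : ℝ) * ((n : ℝ) - 6) * ((n : ℝ) ^ 4 - 20 * (n : ℝ) ^ 2 + 64) / 64
def K0 (n : ℕ) : ℝ := ((n : ℝ) - 6) ^ 2 * ((n : ℝ) - 2) ^ 2 * ((n : ℝ) + 2) ^ 2 / 64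
def K2 (n : ℕ) : ℝ := (3 * (n : ℝ) ^ 4 - 24 * (n : ℝ) ^ 3 + 72 * (n : ℝ) ^ 2 - 96 * (n : ℝ) + 304) / 16
def K4 (n : ℕ) : ℝ := (3 * (n : ℝ) ^ 2 - 12 * (n : ℝ) + 44) / 4

/-- `v` is a (classical, entire) solution of the sixth order ODE (O6). -/
def IsSolO6 (n : ℕ) (v : ℝ → ℝ) : Prop :=
  ContDiff ℝ 6 v ∧ ∀ t : ℝ,
    iteratedDeriv 6 v t - K4 n * iteratedDeriv 4 v t + K2 n * iteratedDeriv 2 v t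
      - K0 n * v t + cN n * |v t| ^ (12 / ((n : ℝ) - 6)) * v t = 0

open Filter

/-- `μ² y - y'' = x` on the whole line, where `y'` is the derivative of `y`. -/
def SolvesHelmholtz (μ : ℝ) (y y' x : ℝ → ℝ) : Prop :=
  (∀ t, HasDerivAt y (y' t) t) ∧ ∀ t, HasDerivAt y' (μ ^ 2 * y t - x t) t

namespace SolvesHelmholtz

variable {μ : ℝ} {y y' x u u' z : ℝ → ℝ}

lemma congr_source (h : SolvesHelmholtz μ y y' x) (hxz : ∀ t, x t = z t) :
    SolvesHelmholtz μ y y' z := by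
  rwa [← funext hxz]

lemma source_unique (h : SolvesHelmholtz μ y y' x) (h₂ : SolvesHelmholtz μ y u' z) (t : ℝ) :
    x t = z t := by
  have e : y' = u' := funext fun t => (h.1 t).unique (h₂.1 t)
  subst e
  linarith [(h.2 t).unique (h₂.2 t)]

lemma add_smul (h : SolvesHelmholtz μ y y' x) (h₂ : SolvesHelmholtz μ u u' z) (k : ℝ) :
    SolvesHelmholtz μ (fun t => y t + k * u t) (fun t => y' t + k * u' t)
      (fun t => x t + k * z t) :=
  ⟨fun t => (h.1 t).add ((h₂.1 t).const_mul k), fun t =>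
    ((h.2 t).add ((h₂.2 t).const_mul k)).congr_deriv (by ring)⟩

lemma neg (h : SolvesHelmholtz μ y y' x) :
    SolvesHelmholtz μ (fun t => -y t) (fun t => -y' t) (fun t => -x t) :=
  ⟨fun t => (h.1 t).fun_neg, fun t => (h.2 t).fun_neg.congr_deriv (by ring)⟩

lemma reflect (h : SolvesHelmholtz μ y y' x) :
    SolvesHelmholtz μ (fun t => y (-t)) (fun t => -y' (-t)) (fun t => x (-t)) := by
  refine ⟨fun t => ?_, fun t => ?_⟩
  · exact ((h.1 (-t)).comp t (hasDerivAt_neg t)).congr_deriv (by ring)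
  · exact ((h.2 (-t)).comp t (hasDerivAt_neg t)).fun_neg.congr_deriv (by ring)

lemma cosh (μ : ℝ) (K : ℝ) : SolvesHelmholtz μ (fun t => K * Real.cosh t)
    (fun t => K * Real.sinh t) (fun t => (μ ^ 2 - 1) * K * Real.cosh t) :=
  ⟨fun t => (Real.hasDerivAt_cosh t).const_mul K,
    fun t => ((Real.hasDerivAt_sinh t).const_mul K).congr_deriv (by ring)⟩

/-- Conjugating by `exp` shifts the parameter by one. -/
lemma exp_mul {x' : ℝ → ℝ} (h : SolvesHelmholtz μ y y' x) (hx : ∀ t, HasDerivAt x (x' t) t) :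
    SolvesHelmholtz (μ + 1) (fun t => exp t * (y' t + μ * y t))
      (fun t => exp t * ((1 + μ) * y' t + (μ + μ ^ 2) * y t - x t))
      (fun t => exp t * (x' t + (μ + 2) * x t)) := by
  refine ⟨fun t => ?_, fun t => ?_⟩
  · exact ((Real.hasDerivAt_exp t).mul ((h.2 t).add ((h.1 t).const_mul μ))).congr_deriv
      (by simp only [Pi.add_apply]; ring)
  · exact ((Real.hasDerivAt_exp t).mul ((((h.2 t).const_mul (1 + μ)).add
      ((h.1 t).const_mul (μ + μ ^ 2))).sub (hx t))).congr_deriv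
      (by simp only [Pi.add_apply, Pi.sub_apply]; ring)

end SolvesHelmholtz

lemma solvesHelmholtz_cosh_rpow (b C T : ℝ) :
    SolvesHelmholtz b (fun t => C * Real.cosh (t - T) ^ (-b))
      (fun t => C * (-b) * (Real.sinh (t - T) * Real.cosh (t - T) ^ (-b - 1)))
      (fun t => C * (b * (b + 1)) * Real.cosh (t - T) ^ (-(b + 2))) := by
  have hc (t : ℝ) : HasDerivAt (fun t => Real.cosh (t - T)) (Real.sinh (t - T)) t := by
    simpa using ((hasDerivAt_id t).sub_const T).cosh
  have hs (t : ℝ) : HasDerivAt (fun t => Real.sinh (t - T)) (Real.cosh (t - T)) t := by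
    simpa using ((hasDerivAt_id t).sub_const T).sinh
  have hpow (t e : ℝ) : HasDerivAt (fun t => Real.cosh (t - T) ^ e)
      (Real.sinh (t - T) * e * Real.cosh (t - T) ^ (e - 1)) t :=
    (hc t).rpow_const (Or.inl (Real.cosh_pos _).ne')
  refine ⟨fun t => ((hpow t (-b)).const_mul C).congr_deriv (by ring), fun t => ?_⟩
  refine (((hs t).mul (hpow t (-b - 1))).const_mul (C * (-b))).congr_deriv ?_
  have hp := Real.cosh_pos (t - T)
  have h1 : Real.cosh (t - T) ^ (-b - 1) = Real.cosh (t - T) * Real.cosh (t - T) ^ (-(b + 2)) := by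
    rw [show -b - 1 = 1 + -(b + 2) by ring, Real.rpow_add hp, Real.rpow_one]
  have h0 : Real.cosh (t - T) ^ (-b) = Real.cosh (t - T) ^ 2 * Real.cosh (t - T) ^ (-(b + 2)) := by
    rw [show -b = 2 + -(b + 2) by ring, Real.rpow_add hp]
    norm_num
  dsimp only
  rw [h1, h0, show -b - 1 - 1 = -(b + 2) by ring]
  linear_combination (C * b * (b + 1) * Real.cosh (t - T) ^ (-(b + 2))) * Real.sinh_sq (t - T)

/-- A differential inequality `w' ≥ l w + c e^{νt}` with `ν > l` forces growth like `e^{νt}`. -/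
lemma eventually_exp_le_of_deriv {w w' : ℝ → ℝ} {l ν c : ℝ} (hw : ∀ t, HasDerivAt w (w' t) t)
    (hl : l < ν) (hc : 0 < c) (h : ∀ᶠ t in atTop, c * exp (ν * t) ≤ w' t - l * w t) :
    ∃ c' > 0, ∀ᶠ t in atTop, c' * exp (ν * t) ≤ w t := by
  obtain ⟨A, hA⟩ := eventually_atTop.1 h
  set d := ν - l with hd
  have hdp : 0 < d := sub_pos.2 hl
  have hder (t : ℝ) : HasDerivAt (fun t => exp (-l * t) * w t - c / d * exp (d * t))
      (exp (-l * t) * (w' t - l * w t - c * exp (ν * t))) t := by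
    have e1 (k : ℝ) : HasDerivAt (fun t => exp (k * t)) (exp (k * t) * k) t := by
      simpa using ((hasDerivAt_id t).const_mul k).exp
    refine (((e1 (-l)).mul (hw t)).sub ((e1 d).const_mul (c / d))).congr_deriv ?_
    have : exp (d * t) = exp (-l * t) * exp (ν * t) := by
      rw [← Real.exp_add]; congr 1; rw [hd]; ring
    rw [this]; field_simp; ring
  have hmono : MonotoneOn (fun t => exp (-l * t) * w t - c / d * exp (d * t)) (Set.Ici A) := by
    refine monotoneOn_of_hasDerivWithinAt_nonneg (convex_Ici A)
      (fun t _ => (hder t).continuousAt.continuousWithinAt)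
      (fun t _ => (hder t).hasDerivWithinAt) fun t ht => ?_
    rw [interior_Ici] at ht
    exact mul_nonneg (exp_pos _).le (by linarith [hA t (le_of_lt ht)])
  set U := exp (-l * A) * w A - c / d * exp (d * A) with hU
  refine ⟨c / d / 2, by positivity, ?_⟩
  have htend : Tendsto (fun t => c / d / 2 * exp (d * t)) atTop atTop :=
    (Real.tendsto_exp_atTop.comp (tendsto_id.const_mul_atTop hdp)).const_mul_atTop (by positivity)
  filter_upwards [htend.eventually_ge_atTop (-U), eventually_ge_atTop A] with t ht htA
  have h1 : U ≤ exp (-l * t) * w t - c / d * exp (d * t) :=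
    hmono Set.self_mem_Ici htA htA
  have h2 : c / d / 2 * exp (d * t) ≤ exp (-l * t) * w t := by linarith
  have h3 : exp (ν * t) = exp (l * t) * exp (d * t) := by
    rw [← Real.exp_add]; congr 1; rw [hd]; ring
  have h4 : exp (l * t) * exp (-l * t) = 1 := by
    rw [← Real.exp_add, show l * t + -l * t = 0 by ring, Real.exp_zero]
  calc c / d / 2 * exp (ν * t) = exp (l * t) * (c / d / 2 * exp (d * t)) := by rw [h3]; ring
    _ ≤ exp (l * t) * (exp (-l * t) * w t) := mul_le_mul_of_nonneg_left h2 (exp_pos _).le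
    _ = w t := by rw [← mul_assoc, h4, one_mul]

/-- `y` is eventually at least a positive multiple of `e^{νt}`. -/
def ExpLarge (ν : ℝ) (y : ℝ → ℝ) : Prop :=
  ∃ c > 0, ∀ᶠ t in atTop, c * exp (ν * t) ≤ y t

lemma SolvesHelmholtz.expLarge {l ν : ℝ} {y y' x : ℝ → ℝ} (h : SolvesHelmholtz l y y' x)
    (hl : 0 < l) (hν : l < ν) (hx : ExpLarge ν (fun t => -x t)) : ExpLarge ν y := by
  obtain ⟨c, hc, hx⟩ := hx
  obtain ⟨c₁, hc₁, h₁⟩ := eventually_exp_le_of_deriv (l := l)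
    (fun t => (h.2 t).add ((h.1 t).const_mul l)) hν hc
    (hx.mono fun t ht => by simp only [Pi.add_apply]; linarith)
  exact eventually_exp_le_of_deriv (l := -l) h.1 (by linarith) hc₁
    (h₁.mono fun t ht => by simp only [Pi.add_apply] at ht; linarith)

lemma not_expLarge {β ν C : ℝ} {y : ℝ → ℝ} (hβ : 0 ≤ β) (hν : β < ν)
    (hy : ∀ t, y t ≤ C * Real.cosh (β * t)) : ¬ ExpLarge ν y := by
  rintro ⟨c, hc, h⟩
  have htend : Tendsto (fun t => c * exp ((ν - β) * t)) atTop atTop :=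
    (Real.tendsto_exp_atTop.comp
      (tendsto_id.const_mul_atTop (sub_pos.2 hν))).const_mul_atTop hc
  obtain ⟨t, h1, h2, h3⟩ := (h.and ((htend.eventually_gt_atTop |C|).and
    (eventually_ge_atTop 0))).exists
  have hcosh : Real.cosh (β * t) ≤ exp (β * t) := by
    rw [Real.cosh_eq]
    have : exp (-(β * t)) ≤ exp (β * t) :=
      Real.exp_le_exp.2 (by linarith [mul_nonneg hβ h3])
    linarith
  have h4 : exp (ν * t) = exp ((ν - β) * t) * exp (β * t) := by
    rw [← Real.exp_add]; congr 1; ring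
  have h5 : y t ≤ |C| * exp (β * t) := (hy t).trans <|
    (mul_le_mul_of_nonneg_right (le_abs_self C) (Real.cosh_pos _).le).trans
      (mul_le_mul_of_nonneg_left hcosh (abs_nonneg C))
  have h6 : |C| * exp (β * t) < c * exp ((ν - β) * t) * exp (β * t) :=
    mul_lt_mul_of_pos_right h2 (exp_pos _)
  rw [h4] at h1
  linarith

lemma SolvesHelmholtz.deriv_ge {μ : ℝ} {y y' x : ℝ → ℝ} (h : SolvesHelmholtz μ y y' x)
    (hμ : 0 < μ) (hx : ∀ t, 0 ≤ x t) (hy : ¬ ExpLarge μ (fun t => -y t)) (s : ℝ) :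
    0 ≤ y' s + μ * y s := by
  by_contra! hs
  refine hy ?_
  have hder (t : ℝ) : HasDerivAt (fun t => exp (-μ * t) * (y' t + μ * y t))
      (-(exp (-μ * t) * x t)) t := by
    have e1 : HasDerivAt (fun t => exp (-μ * t)) (exp (-μ * t) * (-μ)) t := by
      simpa using ((hasDerivAt_id t).const_mul (-μ)).exp
    refine (e1.mul ((h.2 t).add ((h.1 t).const_mul μ))).congr_deriv ?_
    simp only [Pi.add_apply]; ring
  have hanti : Antitone (fun t => exp (-μ * t) * (y' t + μ * y t)) :=
    antitone_of_hasDerivAt_nonpos hder fun t =>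
      neg_nonpos.2 (mul_nonneg (exp_pos _).le (hx t))
  refine eventually_exp_le_of_deriv (l := -μ) (c := -(exp (-μ * s) * (y' s + μ * y s)))
    (fun t => (h.1 t).fun_neg) (by linarith)
    (neg_pos.2 (mul_neg_of_pos_of_neg (exp_pos _) hs)) ?_
  filter_upwards [eventually_ge_atTop s] with t ht
  have h1 := hanti ht
  have h4 : exp (μ * t) * exp (-μ * t) = 1 := by
    rw [← Real.exp_add, show μ * t + -μ * t = 0 by ring, Real.exp_zero]
  have h2 := mul_le_mul_of_nonneg_left h1 (exp_pos (μ * t)).le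
  simp only [← mul_assoc, h4] at h2
  linarith

lemma SolvesHelmholtz.abs_deriv_le {μ : ℝ} {y y' x : ℝ → ℝ} (h : SolvesHelmholtz μ y y' x)
    (hμ : 0 < μ) (hx : ∀ t, 0 ≤ x t) (hy : ¬ ExpLarge μ (fun t => -y t))
    (hy₂ : ¬ ExpLarge μ (fun t => -y (-t))) (s : ℝ) : |y' s| ≤ μ * y s := by
  have h1 := h.deriv_ge hμ hx hy s
  have h2 := h.reflect.deriv_ge hμ (fun t => hx (-t)) hy₂ (-s)
  simp only [neg_neg] at h2
  exact abs_le.2 ⟨by linarith, by linarith⟩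

lemma nonneg_of_abs_le {μ a b : ℝ} (hμ : 0 < μ) (h : |a| ≤ μ * b) : 0 ≤ b :=
  nonneg_of_mul_nonneg_right ((abs_nonneg a).trans h) hμ

/-- Three nested Helmholtz equations: `(μ₁² - D²) (μ₂² - D²) (μ₃² - D²) y = F`. -/
def SolvesTriple (μ₁ μ₂ μ₃ : ℝ) (y y' x F : ℝ → ℝ) : Prop :=
  ∃ x' z z' : ℝ → ℝ, SolvesHelmholtz μ₁ y y' x ∧ SolvesHelmholtz μ₂ x x' z ∧
    SolvesHelmholtz μ₃ z z' F

namespace SolvesTriple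

variable {μ₁ μ₂ μ₃ : ℝ} {y y' x F u u' w G : ℝ → ℝ}

lemma add_smul (h : SolvesTriple μ₁ μ₂ μ₃ y y' x F) (h₂ : SolvesTriple μ₁ μ₂ μ₃ u u' w G)
    (k : ℝ) : SolvesTriple μ₁ μ₂ μ₃ (fun t => y t + k * u t) (fun t => y' t + k * u' t)
      (fun t => x t + k * w t) (fun t => F t + k * G t) := by
  obtain ⟨_, _, _, a1, a2, a3⟩ := h
  obtain ⟨_, _, _, b1, b2, b3⟩ := h₂
  exact ⟨_, _, _, a1.add_smul b1 k, a2.add_smul b2 k, a3.add_smul b3 k⟩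

lemma reflect (h : SolvesTriple μ₁ μ₂ μ₃ y y' x F) :
    SolvesTriple μ₁ μ₂ μ₃ (fun t => y (-t)) (fun t => -y' (-t)) (fun t => x (-t))
      (fun t => F (-t)) := by
  obtain ⟨_, _, _, a1, a2, a3⟩ := h
  exact ⟨_, _, _, a1.reflect, a2.reflect, a3.reflect⟩

lemma cosh (μ₁ μ₂ μ₃ : ℝ) : SolvesTriple μ₁ μ₂ μ₃ (fun t => 1 * Real.cosh t)
    (fun t => 1 * Real.sinh t) (fun t => (μ₁ ^ 2 - 1) * 1 * Real.cosh t)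
    (fun t => (μ₃ ^ 2 - 1) * ((μ₂ ^ 2 - 1) * ((μ₁ ^ 2 - 1) * 1)) * Real.cosh t) :=
  ⟨_, _, _, .cosh μ₁ 1, .cosh μ₂ _, .cosh μ₃ _⟩

/-- Maximum principle for the sixth order operator, under a growth condition on `y` alone. -/
theorem abs_deriv_le (h : SolvesTriple μ₁ μ₂ μ₃ y y' x F) {β C : ℝ} (hβ : 0 ≤ β) (h1 : β < μ₁)
    (h12 : μ₁ < μ₂) (h23 : μ₂ < μ₃) (hF : ∀ t, 0 ≤ F t)
    (hy : ∀ t, |y t| ≤ C * Real.cosh (β * t)) (t : ℝ) : |y' t| ≤ μ₁ * y t := by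
  obtain ⟨x', z, z', a1, a2, a3⟩ := h
  have p1 : 0 < μ₁ := hβ.trans_lt h1
  have p2 : 0 < μ₂ := p1.trans h12
  have p3 : 0 < μ₃ := p2.trans h23
  have gy (ν : ℝ) (hν : β < ν) : ¬ ExpLarge ν y :=
    not_expLarge hβ hν fun t => (le_abs_self _).trans (hy t)
  have gny (ν : ℝ) (hν : β < ν) : ¬ ExpLarge ν (fun t => -y t) :=
    not_expLarge hβ hν fun t => (neg_le_abs _).trans (hy t)
  have hyr (t : ℝ) : |y (-t)| ≤ C * Real.cosh (β * t) := by
    simpa using hy (-t)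
  have gyr (ν : ℝ) (hν : β < ν) : ¬ ExpLarge ν (fun t => y (-t)) :=
    not_expLarge hβ hν fun t => (le_abs_self _).trans (hyr t)
  have gnyr (ν : ℝ) (hν : β < ν) : ¬ ExpLarge ν (fun t => -y (-t)) :=
    not_expLarge hβ hν fun t => (neg_le_abs _).trans (hyr t)
  have hz (t : ℝ) : 0 ≤ z t := by
    refine nonneg_of_abs_le p3 (a3.abs_deriv_le p3 hF (fun hz => ?_) (fun hz => ?_) t)
    · have hx := a2.expLarge p2 h23 hz
      exact gny μ₃ (by linarith) (a1.neg.expLarge p1 (h12.trans h23) (by simpa using hx))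
    · have hx := a2.reflect.expLarge p2 h23 hz
      exact gnyr μ₃ (by linarith)
        (a1.reflect.neg.expLarge p1 (h12.trans h23) (by simpa using hx))
  have hx (t : ℝ) : 0 ≤ x t := by
    refine nonneg_of_abs_le p2 (a2.abs_deriv_le p2 hz (fun hx => ?_) (fun hx => ?_) t)
    · exact gy μ₂ (by linarith) (a1.expLarge p1 h12 hx)
    · exact gyr μ₂ (by linarith) (a1.reflect.expLarge p1 h12 hx)
  exact a1.abs_deriv_le p1 hx (gny μ₁ h1) (gnyr μ₁ h1) t

end SolvesTriple

lemma eq_zero_of_abs_deriv_le {μ : ℝ} {y y' : ℝ → ℝ} (hy : ∀ t, HasDerivAt y (y' t) t)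
    (hμ : 0 < μ) (h : ∀ t, |y' t| ≤ μ * y t) {s : ℝ} (hs : y s = 0) (t : ℝ) : y t = 0 := by
  have e1 (k t : ℝ) : HasDerivAt (fun t => exp (k * t)) (exp (k * t) * k) t := by
    simpa using ((hasDerivAt_id t).const_mul k).exp
  have hder (k t : ℝ) : HasDerivAt (fun t => exp (k * t) * y t)
      (exp (k * t) * (y' t + k * y t)) t :=
    ((e1 k t).mul (hy t)).congr_deriv (by ring)
  refine le_antisymm ?_ (nonneg_of_abs_le hμ (h t))
  rcases le_total t s with hts | hts
  · have hm : Monotone (fun t => exp (μ * t) * y t) :=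
      monotone_of_hasDerivAt_nonneg (hder μ) fun t =>
        mul_nonneg (exp_pos _).le (by linarith [(abs_le.1 (h t)).1])
    have := hm hts
    simp only [hs, mul_zero] at this
    exact nonpos_of_mul_nonpos_right this (exp_pos _)
  · have hm : Antitone (fun t => exp (-μ * t) * y t) :=
      antitone_of_hasDerivAt_nonpos (hder (-μ)) fun t =>
        mul_nonpos_of_nonneg_of_nonpos (exp_pos _).le (by linarith [(abs_le.1 (h t)).2])
    have := hm hts
    simp only [hs, mul_zero] at this
    exact nonpos_of_mul_nonpos_right this (exp_pos _)

section Comparison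

variable {μ₁ μ₂ μ₃ : ℝ} {w : ℝ → ℝ}

/-- Nonnegativity of solutions of the linear equation with a small potential outside `[-R, R]`
propagates from `[-R, R]` to the line. -/
lemma SolvesTriple.nonneg_of_nonneg_on (h1 : 1 < μ₁) (h12 : μ₁ < μ₂) (h23 : μ₂ < μ₃)
    (hw : ∀ t, 0 ≤ w t) {R : ℝ}
    (hR : ∀ t, R < |t| → w t ≤ (μ₃ ^ 2 - 1) * ((μ₂ ^ 2 - 1) * (μ₁ ^ 2 - 1)) / 2)
    {m m' x : ℝ → ℝ} (hm : SolvesTriple μ₁ μ₂ μ₃ m m' x (fun t => w t * m t))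
    {C : ℝ} (hC : ∀ t, |m t| ≤ C * Real.cosh t) (hmR : ∀ t, |t| ≤ R → 0 ≤ m t) (t : ℝ) :
    0 ≤ m t := by
  set P := (μ₃ ^ 2 - 1) * ((μ₂ ^ 2 - 1) * (μ₁ ^ 2 - 1)) with hP
  have hPpos : 0 < P := by
    have q1 : 0 < μ₁ ^ 2 - 1 := by nlinarith
    have q2 : 0 < μ₂ ^ 2 - 1 := by nlinarith
    have q3 : 0 < μ₃ ^ 2 - 1 := by nlinarith
    positivity
  have hC0 : 0 ≤ C := by
    have := (abs_nonneg _).trans (hC 0)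
    simpa using this
  have step (K : ℝ) (hK : 0 ≤ K) (hmK : ∀ t, -(K * Real.cosh t) ≤ m t) (t : ℝ) :
      -(K / 2 * Real.cosh t) ≤ m t := by
    have hs := hm.add_smul (SolvesTriple.cosh μ₁ μ₂ μ₃) (K / 2)
    have hpos := nonneg_of_abs_le (by linarith) (hs.abs_deriv_le (β := 1) (C := C + K / 2)
      zero_le_one h1 h12 h23 (fun t => ?_) (fun t => ?_) t)
    · linarith
    · have hch := Real.cosh_pos t
      have e : K / 2 * ((μ₃ ^ 2 - 1) * ((μ₂ ^ 2 - 1) * ((μ₁ ^ 2 - 1) * 1)) * Real.cosh t)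
          = P / 2 * (K * Real.cosh t) := by rw [hP]; ring
      rw [e]
      rcases le_or_gt |t| R with ht | ht
      · have := mul_nonneg (hw t) (hmR t ht)
        positivity
      · have b1 := mul_le_mul_of_nonneg_left (hmK t) (hw t)
        have b2 := mul_le_mul_of_nonneg_right (hR t ht) (mul_nonneg hK hch.le)
        linarith
    · have hch := Real.cosh_pos t
      rw [one_mul, one_mul]
      refine (abs_add_le _ _).trans ?_
      rw [abs_of_nonneg (by positivity : 0 ≤ K / 2 * Real.cosh t)]
      linarith [hC t]
  have iter (k : ℕ) : ∀ t, -(C / 2 ^ k * Real.cosh t) ≤ m t := by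
    induction k with
    | zero => intro t; simpa using (abs_le.1 (hC t)).1
    | succ k ih =>
      intro t
      have := step _ (by positivity) ih t
      rwa [div_div, ← pow_succ] at this
  have hlim : Tendsto (fun k : ℕ => -(C / 2 ^ k * Real.cosh t)) atTop (nhds 0) := by
    have : Tendsto (fun k : ℕ => C / 2 ^ k) atTop (nhds 0) :=
      tendsto_const_nhds.div_atTop (tendsto_pow_atTop_atTop_of_one_lt one_lt_two)
    simpa using (this.mul_const (Real.cosh t)).neg
  exact le_of_tendsto' hlim fun k => iter k t

/-- Perron-Frobenius: two positive solutions of at most exponential growth are proportional. -/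
theorem SolvesTriple.proportional (h1 : 1 < μ₁) (h12 : μ₁ < μ₂) (h23 : μ₂ < μ₃)
    (hw : ∀ t, 0 ≤ w t) (hwtop : Tendsto w atTop (nhds 0)) (hwbot : Tendsto w atBot (nhds 0))
    {f f' x g g' z : ℝ → ℝ}
    (hf : SolvesTriple μ₁ μ₂ μ₃ f f' x (fun t => w t * f t))
    (hg : SolvesTriple μ₁ μ₂ μ₃ g g' z (fun t => w t * g t))
    (hf0 : ∀ t, 0 < f t) (hg0 : ∀ t, 0 < g t) {C : ℝ}
    (hfC : ∀ t, |f t| ≤ C * Real.cosh t) (hgC : ∀ t, |g t| ≤ C * Real.cosh t) :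
    ∃ k > 0, ∀ t, f t = k * g t := by
  set P := (μ₃ ^ 2 - 1) * ((μ₂ ^ 2 - 1) * (μ₁ ^ 2 - 1)) with hP
  have hPpos : 0 < P / 2 := by
    have q1 : 0 < μ₁ ^ 2 - 1 := by nlinarith
    have q2 : 0 < μ₂ ^ 2 - 1 := by nlinarith
    have q3 : 0 < μ₃ ^ 2 - 1 := by nlinarith
    positivity
  obtain ⟨A, hA⟩ := eventually_atTop.1 (hwtop.eventually_le_const hPpos)
  obtain ⟨B, hB⟩ := eventually_atBot.1 (hwbot.eventually_le_const hPpos)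
  set R := max |A| |B| with hRdef
  have hR0 : 0 ≤ R := (abs_nonneg A).trans (le_max_left _ _)
  have hR (t : ℝ) (ht : R < |t|) : w t ≤ P / 2 := by
    rcases lt_abs.1 ht with h | h
    · exact hA t (((le_abs_self A).trans (le_max_left _ _)).trans h.le)
    · refine hB t ?_
      linarith [neg_le_abs B, le_max_right |A| |B|]
  have hfc : Continuous f := by
    obtain ⟨_, _, _, a1, _, _⟩ := hf
    exact continuous_iff_continuousAt.2 fun t => (a1.1 t).continuousAt
  have hgc : Continuous g := by
    obtain ⟨_, _, _, a1, _, _⟩ := hg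
    exact continuous_iff_continuousAt.2 fun t => (a1.1 t).continuousAt
  obtain ⟨s, -, hs⟩ := (isCompact_Icc (a := -R) (b := R)).exists_isMinOn
    ⟨0, by simpa using hR0⟩ (hfc.div hgc fun t => (hg0 t).ne').continuousOn
  set k := f s / g s with hk
  have hkpos : 0 < k := div_pos (hf0 s) (hg0 s)
  refine ⟨k, hkpos, ?_⟩
  have hm : SolvesTriple μ₁ μ₂ μ₃ (fun t => f t + -k * g t) (fun t => f' t + -k * g' t)
      (fun t => x t + -k * z t) (fun t => w t * (f t + -k * g t)) := by
    have := hf.add_smul hg (-k)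
    rwa [show (fun t => w t * f t + -k * (w t * g t)) = fun t => w t * (f t + -k * g t) from
      funext fun t => by ring] at this
  have hmC (t : ℝ) : |f t + -k * g t| ≤ (C + k * C) * Real.cosh t := by
    refine (abs_add_le _ _).trans ?_
    rw [abs_mul, abs_neg, abs_of_pos hkpos]
    have := mul_le_mul_of_nonneg_left (hgC t) hkpos.le
    linarith [hfC t]
  have hm0 : ∀ t, 0 ≤ f t + -k * g t := by
    refine hm.nonneg_of_nonneg_on h1 h12 h23 hw hR hmC fun t ht => ?_
    have h2 : k ≤ f t / g t := hs (Set.mem_Icc.2 (abs_le.1 ht))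
    rw [le_div_iff₀ (hg0 t)] at h2
    linarith
  have hmd := hm.abs_deriv_le (β := 1) zero_le_one h1 h12 h23
    (fun t => mul_nonneg (hw t) (hm0 t)) (by simpa using hmC)
  have hms : f s + -k * g s = 0 := by
    rw [hk]; field_simp [(hg0 s).ne']; ring
  intro t
  obtain ⟨_, _, _, a1, _, _⟩ := hm
  have := eq_zero_of_abs_deriv_le a1.1 (by linarith) hmd hms t
  linarith

end Comparison

/-- The weighted derivative `eᵗ (v' + a v)` is positive and solves the linear equation with
shifted parameters. -/
lemma exp_mul_deriv_add_pos {a r c M : ℝ} (ha : 0 < a) (hr : a * r = 6) (hc : 0 < c)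
    {v v' x : ℝ → ℝ} (hv : ∀ t, 0 < v t) (hM : ∀ t, v t ≤ M)
    (h : SolvesTriple a (a + 2) (a + 4) v v' x (fun t => c * (v t ^ r * v t))) :
    ∃ f' X : ℝ → ℝ,
      SolvesTriple (a + 1) (a + 3) (a + 5) (fun t => exp t * (v' t + a * v t)) f' X
        (fun t => c * (r + 1) * v t ^ r * (exp t * (v' t + a * v t))) ∧
      (∀ t, 0 < exp t * (v' t + a * v t)) ∧
      ∀ t, |exp t * (v' t + a * v t)| ≤ 4 * (a * M) * Real.cosh t := by
  have hr0 : 0 < r := pos_of_mul_pos_right (by linarith) ha.le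
  have hbound := h.abs_deriv_le (β := 0) (C := M) le_rfl ha (by linarith) (by linarith)
    (fun t => by have := hv t; positivity)
    (fun t => by simpa [abs_of_pos (hv t)] using hM t)
  obtain ⟨x', z, z', a1, a2, a3⟩ := h
  have hF (t : ℝ) : HasDerivAt (fun t => c * (v t ^ r * v t)) (c * (r + 1) * v t ^ r * v' t) t := by
    have hd := (((a1.1 t).rpow_const (p := r) (Or.inl (hv t).ne')).mul (a1.1 t)).const_mul c
    refine hd.congr_deriv ?_
    have : v t ^ r = v t ^ (r - 1) * v t := by
      rw [← Real.rpow_add_one (hv t).ne', sub_add_cancel]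
    rw [this]; ring
  have b1 := a1.exp_mul a2.1
  have b2 := a2.exp_mul a3.1
  have b3 := a3.exp_mul hF
  rw [show a + 2 + 1 = a + 3 by ring, show a + 2 + 2 = a + 4 by ring] at b2
  rw [show a + 4 + 1 = a + 5 by ring, show a + 4 + 2 = a + 6 by ring] at b3
  have hT : SolvesTriple (a + 1) (a + 3) (a + 5) (fun t => exp t * (v' t + a * v t)) _ _
      (fun t => c * (r + 1) * v t ^ r * (exp t * (v' t + a * v t))) :=
    ⟨_, _, _, b1, b2, b3.congr_source fun t => by
      linear_combination (-(exp t * c * v t ^ r * v t)) * hr⟩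
  have hvb (t : ℝ) : 0 ≤ v' t + a * v t := by linarith [(abs_le.1 (hbound t)).1]
  have hnn (t : ℝ) : 0 ≤ exp t * (v' t + a * v t) := mul_nonneg (exp_pos _).le (hvb t)
  have hub (t : ℝ) : |exp t * (v' t + a * v t)| ≤ 4 * (a * M) * Real.cosh t := by
    rw [abs_of_nonneg (hnn t)]
    have i1 : v' t + a * v t ≤ 2 * (a * M) := by
      have := mul_le_mul_of_nonneg_left (hM t) ha.le
      linarith [(abs_le.1 (hbound t)).2]
    have i2 : exp t ≤ 2 * Real.cosh t := by
      rw [Real.cosh_eq]; linarith [exp_pos (-t)]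
    calc exp t * (v' t + a * v t) ≤ 2 * Real.cosh t * (2 * (a * M)) :=
          mul_le_mul i2 i1 (hvb t) (by have := Real.cosh_pos t; positivity)
      _ = 4 * (a * M) * Real.cosh t := by ring
  refine ⟨_, _, hT, fun t => (hnn t).lt_of_ne fun hzero => ?_, hub⟩
  have hfd := hT.abs_deriv_le (β := 1) zero_le_one (by linarith) (by linarith) (by linarith)
    (fun t => mul_nonneg (by have := hv t; positivity) (hnn t)) (by simpa using hub)
  have hall := eq_zero_of_abs_deriv_le b1.1 (by linarith) hfd hzero.symm
  have hder (t : ℝ) : HasDerivAt (fun t => exp (a * t) * v t) 0 t := by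
    have e1 : HasDerivAt (fun t => exp (a * t)) (exp (a * t) * a) t := by
      simpa using ((hasDerivAt_id t).const_mul a).exp
    refine (e1.mul (a1.1 t)).congr_deriv ?_
    linear_combination exp (a * t) * ((mul_eq_zero.1 (hall t)).resolve_left (exp_pos _).ne')
  have hconst (t : ℝ) : exp (a * t) * v t = v 0 := by
    have := is_const_of_deriv_eq_zero (fun t => (hder t).differentiableAt)
      (fun t => (hder t).deriv) t 0
    simpa using this
  have hlim : Tendsto (fun t => exp (a * t) * M) atBot (nhds 0) := by
    simpa using ((Real.tendsto_exp_atBot.comp (tendsto_id.const_mul_atBot ha)).mul_const M)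
  have : v 0 ≤ 0 := ge_of_tendsto' hlim fun t => by
    rw [← hconst t]
    exact mul_le_mul_of_nonneg_left (hM t) (exp_pos _).le
  linarith [hv 0]

/-- A positive function with `cosh (t - T) v' = -a sinh (t - T) v` is a multiple of a power
of `cosh (t - T)`. -/
lemma eq_mul_cosh_rpow {a T : ℝ} {v v' : ℝ → ℝ} (hv : ∀ t, HasDerivAt v (v' t) t)
    (h : ∀ t, Real.cosh (t - T) * v' t = -a * Real.sinh (t - T) * v t) (t : ℝ) :
    v t = v T * Real.cosh (t - T) ^ (-a) := by
  have hder (t : ℝ) : HasDerivAt (fun t => v t * Real.cosh (t - T) ^ a) 0 t := by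
    have hc : HasDerivAt (fun t => Real.cosh (t - T)) (Real.sinh (t - T)) t := by
      simpa using ((hasDerivAt_id t).sub_const T).cosh
    have hp := Real.cosh_pos (t - T)
    refine ((hv t).mul (hc.rpow_const (p := a) (Or.inl hp.ne'))).congr_deriv ?_
    have : Real.cosh (t - T) ^ a = Real.cosh (t - T) ^ (a - 1) * Real.cosh (t - T) := by
      rw [← Real.rpow_add_one hp.ne', sub_add_cancel]
    rw [this]
    linear_combination Real.cosh (t - T) ^ (a - 1) * h t
  have hconst := is_const_of_deriv_eq_zero (fun t => (hder t).differentiableAt)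
    (fun t => (hder t).deriv) t T
  simp only [sub_self, Real.cosh_zero, Real.one_rpow, mul_one] at hconst
  have hp := Real.rpow_pos_of_pos (Real.cosh_pos (t - T)) a
  rw [← hconst, Real.rpow_neg (Real.cosh_pos _).le]
  field_simp

/-- Classification of positive homoclinic solutions for a general exponent `a > 0`. -/
theorem SolvesTriple.eq_cosh_rpow {a r : ℝ} (ha : 0 < a) (hr : a * r = 6)
    {v v' x : ℝ → ℝ} (hv : ∀ t, 0 < v t)
    (htop : Tendsto v atTop (nhds 0)) (hbot : Tendsto v atBot (nhds 0))
    {M : ℝ} (hM : ∀ t, v t ≤ M)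
    (h : SolvesTriple a (a + 2) (a + 4) v v' x (fun t =>
      a * (a + 1) * (a + 2) * (a + 3) * (a + 4) * (a + 5) * (v t ^ r * v t))) :
    ∃ T : ℝ, ∀ t, v t = Real.cosh (t - T) ^ (-a) := by
  set c := a * (a + 1) * (a + 2) * (a + 3) * (a + 4) * (a + 5) with hcdef
  have hc : 0 < c := by positivity
  have hr0 : 0 < r := pos_of_mul_pos_right (by linarith) ha.le
  obtain ⟨f', X, hf, hfpos, hfb⟩ := exp_mul_deriv_add_pos ha hr hc hv hM h
  obtain ⟨g', Z, hg, hgpos, hgb⟩ := exp_mul_deriv_add_pos ha hr hc (fun t => hv (-t))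
    (fun t => hM (-t)) h.reflect
  have hg := hg.reflect
  simp only [neg_neg] at hg
  have hw (l : Filter ℝ) (hl : Tendsto v l (nhds 0)) :
      Tendsto (fun t => c * (r + 1) * v t ^ r) l (nhds 0) := by
    have := (hl.rpow_const (p := r) (Or.inr hr0.le)).const_mul (c * (r + 1))
    simpa [Real.zero_rpow hr0.ne'] using this
  obtain ⟨k, hk, hfg⟩ := SolvesTriple.proportional (by linarith) (by linarith) (by linarith)
    (fun t => by have := hv t; positivity) (hw _ htop) (hw _ hbot) hf hg hfpos
    (fun t => by simpa using hgpos (-t)) hfb (fun t => by simpa using hgb (-t))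
  have hvT : ∀ t, Real.cosh (t - log k / 2) * v' t = -a * Real.sinh (t - log k / 2) * v t := by
    intro t
    set E := exp (log k / 2) with hE
    have hE0 : 0 < E := exp_pos _
    have hkE : k = E * E := by
      rw [hE, ← Real.exp_add, add_halves, Real.exp_log hk]
    have h1 := hfg t
    rw [Real.cosh_eq, Real.sinh_eq, neg_sub, Real.exp_sub, Real.exp_sub, ← hE]
    rw [hkE, Real.exp_neg] at h1
    have := exp_pos t
    field_simp at h1 ⊢
    linear_combination h1
  obtain ⟨x', z, z', a1, a2, a3⟩ := h
  set T := log k / 2 with hT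
  have hvC := eq_mul_cosh_rpow a1.1 hvT
  have b1 := solvesHelmholtz_cosh_rpow a (v T) T
  rw [← funext hvC] at b1
  have e1 := funext (a1.source_unique b1)
  rw [e1] at a2
  have e2 := funext (a2.source_unique (solvesHelmholtz_cosh_rpow (a + 2) _ T))
  rw [e2, show a + 2 + 2 = a + 4 by ring] at a3
  have e3 := a3.source_unique (solvesHelmholtz_cosh_rpow (a + 4) _ T) T
  simp only [sub_self, Real.cosh_zero, Real.one_rpow, mul_one] at e3
  have e4 : c * v T * (v T ^ r - 1) = 0 := by
    rw [hcdef] at e3 ⊢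
    linear_combination e3
  have e5 : v T ^ r = 1 := by
    have := (mul_eq_zero.1 e4).resolve_left (mul_pos hc (hv T)).ne'
    linarith
  have e6 : v T = 1 :=
    (Real.rpow_left_inj (hv T).le zero_le_one hr0.ne').1 (e5.trans (Real.one_rpow r).symm)
  exact ⟨T, fun t => by rw [hvC t, e6, one_mul]⟩

theorem closed_form_of_homoclinic_solutions
    (n : ℕ) (hn : 7 ≤ n) (v : ℝ → ℝ) (hv : IsSolO6 n v)
    (hb : ∃ M : ℝ, ∀ t : ℝ, |v t| ≤ M) (hpos : ∀ t : ℝ, 0 < v t)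
    (hlim : Tendsto v atTop (nhds 0) ∧ Tendsto v atBot (nhds 0)) :
    ∃ T : ℝ, ∀ t : ℝ, v t = Real.cosh (t - T) ^ (-(((n : ℝ) - 6) / 2)) := by
  obtain ⟨hsmooth, hode⟩ := hv
  obtain ⟨M, hM⟩ := hb
  have hn7 : (7 : ℝ) ≤ n := by exact_mod_cast hn
  set a := ((n : ℝ) - 6) / 2 with ha
  have ha0 : 0 < a := by rw [ha]; linarith
  have hn6 : (n : ℝ) - 6 ≠ 0 := by linarith
  have hna : (n : ℝ) = 2 * a + 6 := by rw [ha]; ring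
  have hd (i : ℕ) (hi : i < 6) (t : ℝ) :
      HasDerivAt (iteratedDeriv i v) (iteratedDeriv (i + 1) v t) t := by
    rw [iteratedDeriv_succ]
    exact ((hsmooth.differentiable_iteratedDeriv i (by exact_mod_cast hi)) t).hasDerivAt
  have hd0 (t : ℝ) : HasDerivAt v (iteratedDeriv 1 v t) t := by
    simpa using hd 0 (by norm_num) t
  have h1 : SolvesHelmholtz a v (iteratedDeriv 1 v)
      (fun t => a ^ 2 * v t - iteratedDeriv 2 v t) :=
    ⟨hd0, fun t => (hd 1 (by norm_num) t).congr_deriv (by ring)⟩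
  have h2 : SolvesHelmholtz (a + 2) (fun t => a ^ 2 * v t - iteratedDeriv 2 v t)
      (fun t => a ^ 2 * iteratedDeriv 1 v t - iteratedDeriv 3 v t)
      (fun t => (a + 2) ^ 2 * (a ^ 2 * v t - iteratedDeriv 2 v t)
        - (a ^ 2 * iteratedDeriv 2 v t - iteratedDeriv 4 v t)) :=
    ⟨fun t => ((hd0 t).const_mul _).sub (hd 2 (by norm_num) t),
      fun t => (((hd 1 (by norm_num) t).const_mul _).sub (hd 3 (by norm_num) t)).congr_deriv
        (by ring)⟩
  have h3 : SolvesHelmholtz (a + 4) (fun t => (a + 2) ^ 2 * (a ^ 2 * v t - iteratedDeriv 2 v t)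
        - (a ^ 2 * iteratedDeriv 2 v t - iteratedDeriv 4 v t))
      (fun t => (a + 2) ^ 2 * (a ^ 2 * iteratedDeriv 1 v t - iteratedDeriv 3 v t)
        - (a ^ 2 * iteratedDeriv 3 v t - iteratedDeriv 5 v t))
      (fun t => a * (a + 1) * (a + 2) * (a + 3) * (a + 4) * (a + 5) *
        (v t ^ (12 / ((n : ℝ) - 6)) * v t)) := by
    refine ⟨fun t => ((((hd0 t).const_mul _).sub (hd 2 (by norm_num) t)).const_mul _).sub
      (((hd 2 (by norm_num) t).const_mul _).sub (hd 4 (by norm_num) t)), fun t => ?_⟩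
    refine (((((hd 1 (by norm_num) t).const_mul _).sub (hd 3 (by norm_num) t)).const_mul _).sub
      (((hd 3 (by norm_num) t).const_mul _).sub (hd 5 (by norm_num) t))).congr_deriv ?_
    have ht := hode t
    rw [abs_of_pos (hpos t), cN, K0, K2, K4] at ht
    dsimp only
    generalize v t ^ (12 / ((n : ℝ) - 6)) = p at ht ⊢
    rw [hna] at ht
    linear_combination ht
  refine SolvesTriple.eq_cosh_rpow ha0 ?_ hpos hlim.1 hlim.2
    (fun t => (le_abs_self _).trans (hM t)) ⟨_, _, _, h1, h2, h3⟩
  rw [ha]; field_simp; norm_num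
end
end

section
/- Let v be a solution of the ODE (O6). Then inf_{t ∈ ℝ} |v(t)| ≤ a*_n, and equality holds if and only if v is a nonzero constant function (i.e. v ≡ a*_n or v ≡ -a*_n). -/
noncomputable section

open Real

def aStar (n : ℕ) : ℝ := (K0 n / cN n) ^ (((n : ℝ) - 6) / 12)

/-- Two integrations by parts against a function vanishing to first order at the endpoints. -/
theorem integral_second_deriv_mul_eq {f f' f'' φ φ' φ'' : ℝ → ℝ} {a b : ℝ}
    (hf : ∀ t, HasDerivAt f (f' t) t) (hf' : ∀ t, HasDerivAt f' (f'' t) t)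
    (hf'' : Continuous f'')
    (hφ : ∀ t, HasDerivAt φ (φ' t) t) (hφ' : ∀ t, HasDerivAt φ' (φ'' t) t)
    (hφ'' : Continuous φ'')
    (ha : φ a = 0) (hb : φ b = 0) (ha' : φ' a = 0) (hb' : φ' b = 0) :
    ∫ t in a..b, f'' t * φ t = ∫ t in a..b, f t * φ'' t := by
  have cf' : Continuous f' := continuous_iff_continuousAt.2 fun t => (hf' t).continuousAt
  have cφ' : Continuous φ' := continuous_iff_continuousAt.2 fun t => (hφ' t).continuousAt
  have h1 := intervalIntegral.integral_mul_deriv_eq_deriv_mul (a := a) (b := b)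
    (fun t _ => hφ t) (fun t _ => hf' t)
    (cφ'.intervalIntegrable _ _) (hf''.intervalIntegrable _ _)
  have h2 := intervalIntegral.integral_mul_deriv_eq_deriv_mul (a := a) (b := b)
    (fun t _ => hφ' t) (fun t _ => hf t)
    (hφ''.intervalIntegrable _ _) (cf'.intervalIntegrable _ _)
  simp only [ha, hb, ha', hb', zero_mul, sub_self, zero_sub] at h1 h2
  simp only [mul_comm (f'' _), mul_comm (f _), h1, h2, neg_neg]

/-- An absorption inequality of Young type. -/
theorem exists_mul_pow_le_rpow_mul_pow_add {C k q : ℝ} (hC : 0 ≤ C) (hk : 0 < k) (hq : 0 < q)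
    {N : ℕ} (hN : 6 / q ≤ N) :
    ∃ D, ∀ h s ε : ℝ, 0 ≤ h → 0 ≤ s → s ≤ 1 → 0 ≤ ε → ε ≤ 1 →
      h * (C * ε * s ^ N) ≤ k * h ^ (1 + q) * s ^ (N + 6) + D * ε := by
  refine ⟨C * (C / k) ^ (1 / q), fun h s ε hh hs hs1 hε hε1 => ?_⟩
  have hD : 0 ≤ (C / k) ^ (1 / q) := by positivity
  rcases le_or_gt (C * ε) (k * (h ^ q * s ^ 6)) with h1 | h1
  · have h2 : h ^ (1 + q) = h * h ^ q := by
      rw [Real.rpow_add' hh (by positivity), Real.rpow_one]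
    have h3 : h * (C * ε * s ^ N) ≤ h * (k * (h ^ q * s ^ 6) * s ^ N) := by gcongr
    have h4 : 0 ≤ C * (C / k) ^ (1 / q) * ε := by positivity
    rw [h2, pow_add]
    linarith
  · have h2 : h ^ q * s ^ 6 ≤ C / k := by
      rw [le_div_iff₀ hk]
      nlinarith [mul_le_mul_of_nonneg_left hε1 hC]
    have h3 : (h * s ^ N) ^ q ≤ h ^ q * s ^ 6 := by
      rw [Real.mul_rpow hh (by positivity), ← Real.rpow_natCast s N, ← Real.rpow_mul hs]
      gcongr
      rcases hs.eq_or_lt with rfl | hs0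
      · have hN0 : 0 < (N : ℝ) := lt_of_lt_of_le (by positivity) hN
        rw [Real.zero_rpow (by positivity)]
        positivity
      · rw [← Real.rpow_natCast s 6]
        apply Real.rpow_le_rpow_of_exponent_ge hs0 hs1
        rw [div_le_iff₀ hq] at hN
        exact_mod_cast hN
    have h4 : h * s ^ N ≤ (C / k) ^ (1 / q) := by
      have := Real.rpow_le_rpow (by positivity) (h3.trans h2) (by positivity : 0 ≤ 1 / q)
      rwa [← Real.rpow_mul (by positivity), mul_one_div_cancel hq.ne', Real.rpow_one] at this
    have h5 : C * ε * (h * s ^ N) ≤ C * ε * (C / k) ^ (1 / q) := by gcongr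
    have h6 : 0 ≤ k * h ^ (1 + q) * s ^ (N + 6) := by positivity
    linarith

/-- Convexity estimate behind the superlinear lower bound for the nonlinearity. -/
theorem min_mul_rpow_sub_le {a u q : ℝ} (ha : 0 < a) (hu : a ≤ u) (hq : 0 < q) :
    min 1 q * (u - a) ^ (1 + q) ≤ u * (u ^ q - a ^ q) := by
  have hu0 : 0 < u := ha.trans_le hu
  have hd : 0 ≤ u - a := sub_nonneg.2 hu
  rw [Real.rpow_add' hd (by positivity), Real.rpow_one]
  have hm : (u - a) ^ q ≤ u ^ q := Real.rpow_le_rpow hd (by linarith) hq.le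
  have hp : 0 ≤ (u - a) ^ q := Real.rpow_nonneg hd q
  rcases le_total 1 q with h1 | h1
  · rw [min_eq_left h1]
    have := Real.add_rpow_le_rpow_add hd ha.le h1
    rw [sub_add_cancel] at this
    nlinarith
  · rw [min_eq_right h1]
    have hb := rpow_one_add_le_one_add_mul_self (s := a / u - 1)
      (by linarith [div_pos ha hu0]) hq.le h1
    rw [add_sub_cancel, Real.div_rpow ha.le hu0.le, div_le_iff₀ (by positivity)] at hb
    have h2 : u * ((1 + q * (a / u - 1)) * u ^ q) = u * u ^ q - q * (u - a) * u ^ q := by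
      field_simp
      ring
    have h3 := mul_le_mul_of_nonneg_left hb hu0.le
    have h4 : q * (u - a) * (u - a) ^ q ≤ q * (u - a) * u ^ q := by gcongr
    linarith

open Polynomial in
/-- The bump polynomial `(1 - X²)^m`. -/
def bumpPoly (m : ℕ) : ℝ[X] := (1 - X ^ 2) ^ m

open Polynomial in
theorem abs_eval_iterate_derivative_bumpPoly_le (N : ℕ) :
    ∃ C, 0 ≤ C ∧ ∀ j ≤ 6, ∀ x ∈ Set.Icc (-1 : ℝ) 1,
      |(derivative^[j] (bumpPoly (N + 6))).eval x| ≤ C * (1 - x ^ 2) ^ N := by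
  have key : ∀ j ≤ 6, ∃ C, 0 ≤ C ∧ ∀ x ∈ Set.Icc (-1 : ℝ) 1,
      |(derivative^[j] (bumpPoly (N + 6))).eval x| ≤ C * (1 - x ^ 2) ^ N := by
    intro j hj
    have hdvd : (1 - X ^ 2 : ℝ[X]) ^ N ∣ derivative^[j] (bumpPoly (N + 6)) :=
      (pow_dvd_pow _ (by omega)).trans
        (pow_sub_dvd_iterate_derivative_pow (1 - X ^ 2 : ℝ[X]) (N + 6) j)
    obtain ⟨Q, hQ⟩ := hdvd
    obtain ⟨C, hC⟩ := (isCompact_Icc (a := (-1 : ℝ)) (b := 1)).exists_bound_of_continuousOn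
      Q.continuous.continuousOn
    refine ⟨C, (norm_nonneg _).trans (hC 0 (by simp)), fun x hx => ?_⟩
    have hs : 0 ≤ 1 - x ^ 2 := by nlinarith [hx.1, hx.2]
    have := hC x hx
    rw [Real.norm_eq_abs] at this
    rw [hQ, eval_mul, eval_pow, eval_sub, eval_one, eval_pow, eval_X, abs_mul,
      abs_of_nonneg (pow_nonneg hs N), mul_comm]
    gcongr
  choose! C hC0 hC using key
  refine ⟨∑ j ∈ Finset.range 7, C j,
    Finset.sum_nonneg fun j hj => hC0 j (by simp at hj; omega), fun j hj x hx => ?_⟩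
  have hs : 0 ≤ 1 - x ^ 2 := by nlinarith [hx.1, hx.2]
  refine (hC j hj x hx).trans (mul_le_mul_of_nonneg_right ?_ (pow_nonneg hs N))
  exact Finset.single_le_sum (f := C) (fun j hj => hC0 j (by simp at hj; omega))
    (by simp; omega)

/-- The `j`-th derivative of the rescaled bump `t ↦ (1 - (t / R)²)^m`. -/
def scaledBump (m : ℕ) (R : ℝ) (j : ℕ) (t : ℝ) : ℝ :=
  (Polynomial.derivative^[j] (bumpPoly m)).eval (t / R) / R ^ j

theorem hasDerivAt_scaledBump (m : ℕ) (R : ℝ) (j : ℕ) (t : ℝ) :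
    HasDerivAt (scaledBump m R j) (scaledBump m R (j + 1) t) t := by
  have h := (((Polynomial.derivative^[j] (bumpPoly m)).hasDerivAt (t / R)).comp t
    ((hasDerivAt_id t).div_const R)).div_const (R ^ j)
  refine (show HasDerivAt (scaledBump m R j) _ t from h).congr_deriv ?_
  simp only [scaledBump, Function.iterate_succ_apply', pow_succ]
  ring

theorem continuous_scaledBump (m : ℕ) (R : ℝ) (j : ℕ) : Continuous (scaledBump m R j) :=
  continuous_iff_continuousAt.2 fun t => (hasDerivAt_scaledBump m R j t).continuousAt

theorem scaledBump_zero (m : ℕ) (R t : ℝ) : scaledBump m R 0 t = (1 - (t / R) ^ 2) ^ m := by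
  simp [scaledBump, bumpPoly]

theorem div_mem_Icc {R t : ℝ} (hR : 0 < R) (ht : t ∈ Set.Icc (-R) R) :
    t / R ∈ Set.Icc (-1 : ℝ) 1 :=
  ⟨by rw [le_div_iff₀ hR]; linarith [ht.1], by rw [div_le_iff₀ hR]; linarith [ht.2]⟩

theorem scaledBump_eq_zero {N : ℕ} (hN : N ≠ 0) {R t : ℝ}
    (ht : (t / R) ^ 2 = 1) {j : ℕ} (hj : j ≤ 6) : scaledBump (N + 6) R j t = 0 := by
  obtain ⟨C, -, hC⟩ := abs_eval_iterate_derivative_bumpPoly_le N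
  have hx : t / R ∈ Set.Icc (-1 : ℝ) 1 := abs_le.1 (by rw [← sq_le_one_iff_abs_le_one, ht])
  have := hC j hj _ hx
  rw [ht, sub_self, zero_pow hN, mul_zero, abs_nonpos_iff] at this
  rw [scaledBump, this, zero_div]

/-- Integration by parts for the operator `D⁶ - A D⁴ + B D²` against the rescaled bump. -/
theorem integral_mul_scaledBump_eq {g : ℕ → ℝ → ℝ}
    (hg : ∀ i < 6, ∀ t, HasDerivAt (g i) (g (i + 1) t) t) (hc : ∀ i ≤ 6, Continuous (g i))
    (A B : ℝ) {N : ℕ} (hN : N ≠ 0) {R : ℝ} (hR : 0 < R) :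
    ∫ x in (-R)..R, -(g 6 x - A * g 4 x + B * g 2 x) * scaledBump (N + 6) R 0 x
      = ∫ x in (-R)..R, g 0 x * -(scaledBump (N + 6) R 6 x - A * scaledBump (N + 6) R 4 x
          + B * scaledBump (N + 6) R 2 x) := by
  have dφ := hasDerivAt_scaledBump (N + 6) R
  have cφ := continuous_scaledBump (N + 6) R
  have zr : ∀ j ≤ 6, scaledBump (N + 6) R j R = 0 := fun j hj =>
    scaledBump_eq_zero hN (by field_simp) hj
  have zl : ∀ j ≤ 6, scaledBump (N + 6) R j (-R) = 0 := fun j hj =>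
    scaledBump_eq_zero hN (by field_simp) hj
  generalize scaledBump (N + 6) R = φ at dφ cφ zr zl ⊢
  have parts : ∀ i < 5, ∀ j < 5, ∫ x in (-R)..R, g (i + 2) x * φ j x
      = ∫ x in (-R)..R, g i x * φ (j + 2) x := fun i hi j hj =>
    integral_second_deriv_mul_eq (hg i (by omega)) (hg (i + 1) (by omega))
      (hc (i + 2) (by omega)) (dφ j) (dφ (j + 1)) (cφ _) (zl j (by omega)) (zr j (by omega))
      (zl _ (by omega)) (zr _ (by omega))
  have e2 : ∫ x in (-R)..R, g 2 x * φ 0 x = ∫ x in (-R)..R, g 0 x * φ 2 x :=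
    parts 0 (by norm_num) 0 (by norm_num)
  have e4 : ∫ x in (-R)..R, g 4 x * φ 0 x = ∫ x in (-R)..R, g 0 x * φ 4 x :=
    (parts 2 (by norm_num) 0 (by norm_num)).trans (parts 0 (by norm_num) 2 (by norm_num))
  have e6 : ∫ x in (-R)..R, g 6 x * φ 0 x = ∫ x in (-R)..R, g 0 x * φ 6 x :=
    ((parts 4 (by norm_num) 0 (by norm_num)).trans
      (parts 2 (by norm_num) 2 (by norm_num))).trans (parts 0 (by norm_num) 4 (by norm_num))
  have int : ∀ i ≤ 6, ∀ j, IntervalIntegrable (fun x => g i x * φ j x) MeasureTheory.volume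
      (-R) R := fun i hi j => ((hc i hi).mul (cφ j)).intervalIntegrable _ _
  have l : ∀ x, -(g 6 x - A * g 4 x + B * g 2 x) * φ 0 x
      = A * (g 4 x * φ 0 x) - g 6 x * φ 0 x - B * (g 2 x * φ 0 x) := fun x => by ring
  have r : ∀ x, g 0 x * -(φ 6 x - A * φ 4 x + B * φ 2 x)
      = A * (g 0 x * φ 4 x) - g 0 x * φ 6 x - B * (g 0 x * φ 2 x) := fun x => by ring
  simp only [l, r]
  have split : ∀ {p₁ p₂ p₃ : ℝ → ℝ}, IntervalIntegrable p₁ MeasureTheory.volume (-R) R →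
      IntervalIntegrable p₂ MeasureTheory.volume (-R) R →
      IntervalIntegrable p₃ MeasureTheory.volume (-R) R →
      ∫ x in (-R)..R, (A * p₁ x - p₂ x - B * p₃ x)
        = A * (∫ x in (-R)..R, p₁ x) - (∫ x in (-R)..R, p₂ x) - B * ∫ x in (-R)..R, p₃ x := by
    intro p₁ p₂ p₃ h₁ h₂ h₃
    rw [intervalIntegral.integral_sub ((h₁.const_mul A).sub h₂) (h₃.const_mul B),
      intervalIntegral.integral_sub (h₁.const_mul A) h₂]
    simp only [intervalIntegral.integral_const_mul]
  rw [split (int 4 (by norm_num) 0) (int 6 (by norm_num) 0) (int 2 (by norm_num) 0),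
    split (int 0 (by norm_num) 4) (int 0 (by norm_num) 6) (int 0 (by norm_num) 2), e2, e4, e6]

theorem abs_scaledBump_le {N : ℕ} {C : ℝ}
    (hC : ∀ j ≤ 6, ∀ x ∈ Set.Icc (-1 : ℝ) 1,
      |(Polynomial.derivative^[j] (bumpPoly (N + 6))).eval x| ≤ C * (1 - x ^ 2) ^ N)
    {R : ℝ} (hR : 1 ≤ R) {x : ℝ} (hx : x ∈ Set.Icc (-R) R) {j : ℕ} (hj₂ : 2 ≤ j) (hj : j ≤ 6) :
    |scaledBump (N + 6) R j x| ≤ C * (1 - (x / R) ^ 2) ^ N * (1 / R ^ 2) := by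
  have hR0 : 0 < R := by linarith
  have h := hC j hj _ (div_mem_Icc hR0 hx)
  have hp : R ^ 2 ≤ R ^ j := pow_le_pow_right₀ hR hj₂
  rw [scaledBump, abs_div, abs_of_pos (pow_pos hR0 j), div_eq_mul_one_div]
  exact mul_le_mul h (one_div_le_one_div_of_le (by positivity) hp) (by positivity)
    ((abs_nonneg _).trans h)

theorem neg_combination_le {x₂ x₄ x₆ A B E : ℝ} (h₂ : |x₂| ≤ E) (h₄ : |x₄| ≤ E) (h₆ : |x₆| ≤ E) :
    -(x₆ - A * x₄ + B * x₂) ≤ (1 + |A| + |B|) * E := by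
  have h4 : A * x₄ ≤ |A| * E := by
    refine (le_abs_self _).trans ?_
    rw [abs_mul]
    gcongr
  have h2 : -(B * x₂) ≤ |B| * E := by
    refine (neg_le_abs _).trans ?_
    rw [abs_mul]
    gcongr
  have h6 := (neg_le_abs x₆).trans h₆
  linarith

/-- The integral of the defect of a sixth order superlinear inequality against the bump of
width `R` is `O(1 / R)`. -/
theorem exists_integral_mul_scaledBump_le {g : ℕ → ℝ → ℝ}
    (hg : ∀ i < 6, ∀ t, HasDerivAt (g i) (g (i + 1) t) t) (hc : ∀ i ≤ 6, Continuous (g i))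
    {A B k q : ℝ} (hk : 0 < k) (hq : 0 < q) (h0 : ∀ t, 0 ≤ g 0 t)
    (hineq : ∀ t, k * g 0 t ^ (1 + q) ≤ -(g 6 t - A * g 4 t + B * g 2 t)) :
    ∃ (m : ℕ) (D : ℝ), ∀ R : ℝ, 1 ≤ R →
      ∫ x in (-R)..R, -(g 6 x - A * g 4 x + B * g 2 x) * scaledBump m R 0 x ≤ D / R := by
  obtain ⟨N, hN⟩ := exists_nat_ge (6 / q)
  have hN0 : N ≠ 0 := by
    rintro rfl
    have : 0 < 6 / q := by positivity
    rw [Nat.cast_zero] at hN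
    linarith
  obtain ⟨C₀, hC₀, hbump⟩ := abs_eval_iterate_derivative_bumpPoly_le N
  obtain ⟨D, hD⟩ := exists_mul_pow_le_rpow_mul_pow_add (C := C₀ * (1 + |A| + |B|))
    (by positivity) (half_pos hk) hq hN
  refine ⟨N + 6, 4 * D, fun R hR => ?_⟩
  have hR0 : 0 < R := by linarith
  have ibp := integral_mul_scaledBump_eq hg hc A B hN0 hR0
  have pt : ∀ x ∈ Set.Icc (-R) R,
      g 0 x * -(scaledBump (N + 6) R 6 x - A * scaledBump (N + 6) R 4 x
        + B * scaledBump (N + 6) R 2 x)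
      ≤ 1 / 2 * (-(g 6 x - A * g 4 x + B * g 2 x) * scaledBump (N + 6) R 0 x)
        + D * (1 / R ^ 2) := by
    intro x hx
    have hy := div_mem_Icc hR0 hx
    have hs : 0 ≤ 1 - (x / R) ^ 2 := by nlinarith [hy.1, hy.2]
    have hs1 : 1 - (x / R) ^ 2 ≤ 1 := by linarith [sq_nonneg (x / R)]
    have hε : 1 / R ^ 2 ≤ 1 := by
      rw [div_le_one (by positivity)]
      exact one_le_pow₀ hR
    have hsum := neg_combination_le (A := A) (B := B)
      (abs_scaledBump_le hbump hR hx (by norm_num) (by norm_num : 2 ≤ 6))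
      (abs_scaledBump_le hbump hR hx (by norm_num) (by norm_num : 4 ≤ 6))
      (abs_scaledBump_le hbump hR hx (by norm_num) (by norm_num : 6 ≤ 6))
    rw [scaledBump_zero]
    generalize 1 - (x / R) ^ 2 = s at hs hs1 hsum ⊢
    have h1 := mul_le_mul_of_nonneg_left hsum (h0 x)
    have h2 := hD (g 0 x) s (1 / R ^ 2) (h0 x) hs hs1 (by positivity) hε
    have h4 := mul_le_mul_of_nonneg_right (hineq x) (pow_nonneg hs (N + 6))
    linarith
  have c0 := hc 0 (by norm_num)
  have cF : Continuous fun x => -(g 6 x - A * g 4 x + B * g 2 x) :=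
    (((hc 6 (by norm_num)).sub ((hc 4 (by norm_num)).const_mul A)).add
      ((hc 2 (by norm_num)).const_mul B)).neg
  have cφ := continuous_scaledBump (N + 6) R
  have cψ : Continuous fun x => -(scaledBump (N + 6) R 6 x - A * scaledBump (N + 6) R 4 x
      + B * scaledBump (N + 6) R 2 x) :=
    (((cφ 6).sub ((cφ 4).const_mul A)).add ((cφ 2).const_mul B)).neg
  have int := ((cF.mul (cφ 0)).const_mul (1 / 2)).intervalIntegrable (μ := MeasureTheory.volume)
    (-R) R
  have mono := intervalIntegral.integral_mono_on (by linarith : -R ≤ R)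
    ((c0.mul cψ).intervalIntegrable _ _)
    (int.add (continuous_const.intervalIntegrable _ _)) pt
  simp only [Pi.mul_apply] at mono int
  rw [← ibp, intervalIntegral.integral_add int (continuous_const.intervalIntegrable _ _),
    intervalIntegral.integral_const_mul, intervalIntegral.integral_const, smul_eq_mul] at mono
  have e1 : (R - -R) * (D * (1 / R ^ 2)) = 2 * D / R := by
    field_simp
    ring
  have e2 : 4 * D / R = 2 * (2 * D / R) := by ring
  rw [e1] at mono
  linarith

/-- A nonnegative continuous function whose integrals against wide bumps tend to zero vanishes. -/
theorem eq_zero_of_integral_mul_scaledBump_le {F : ℝ → ℝ} (cF : Continuous F)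
    (hF0 : ∀ t, 0 ≤ F t) {m : ℕ} {D : ℝ}
    (hF : ∀ R : ℝ, 1 ≤ R → ∫ x in (-R)..R, F x * scaledBump m R 0 x ≤ D / R) (t : ℝ) :
    F t = 0 := by
  set r := |t| + 1 with hr
  have hr1 : 1 ≤ r := by linarith [abs_nonneg t]
  have loc : ∀ R : ℝ, 2 * r ≤ R → (3 / 4) ^ m * ∫ x in (-r)..r, F x ≤ D / R := by
    intro R hR
    have hR0 : 0 < R := by linarith
    refine le_trans ?_ (hF R (by linarith))
    have cφ := continuous_scaledBump m R 0
    rw [← intervalIntegral.integral_const_mul]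
    refine (intervalIntegral.integral_mono_on (g := fun x => F x * scaledBump m R 0 x)
      (by linarith) ((cF.const_mul _).intervalIntegrable _ _)
      ((cF.mul cφ).intervalIntegrable _ _) fun x hx => ?_).trans
      (intervalIntegral.integral_mono_interval (by linarith) (by linarith) (by linarith)
        ?_ ((cF.mul cφ).intervalIntegrable _ _))
    · rw [scaledBump_zero, mul_comm]
      refine mul_le_mul_of_nonneg_left (pow_le_pow_left₀ (by norm_num) ?_ _) (hF0 x)
      have : |x / R| ≤ 1 / 2 := by
        rw [abs_div, abs_of_pos hR0, div_le_iff₀ hR0]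
        linarith [abs_le.2 hx]
      have := sq_le_sq' (by linarith [neg_abs_le (x / R)]) ((le_abs_self _).trans this)
      linarith
    · refine (MeasureTheory.ae_restrict_iff' measurableSet_Ioc).2 (Filter.Eventually.of_forall
        fun x hx => mul_nonneg (hF0 x) ?_)
      have hy := div_mem_Icc hR0 (Set.Ioc_subset_Icc_self hx)
      rw [scaledBump_zero]
      exact pow_nonneg (by nlinarith [hy.1, hy.2]) _
  have lim : Filter.Tendsto (fun R : ℝ => D / R) Filter.atTop (nhds 0) :=
    Filter.tendsto_id.const_div_atTop D
  have hle := ge_of_tendsto lim ((Filter.eventually_ge_atTop (2 * r)).mono loc)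
  by_contra hne
  have hpos := intervalIntegral.integral_pos (a := -r) (b := r) (by linarith) cF.continuousOn
    (fun x _ => hF0 x)
    ⟨t, ⟨by linarith [neg_abs_le t], by linarith [le_abs_self t]⟩,
      lt_of_le_of_ne (hF0 t) (Ne.symm hne)⟩
  have : 0 < (3 / 4 : ℝ) ^ m * ∫ x in (-r)..r, F x := by positivity
  linarith

/-- A Liouville theorem for nonnegative solutions of a sixth order differential inequality with
superlinear right-hand side. -/
theorem eq_zero_of_sixth_order_inequality {g : ℕ → ℝ → ℝ}
    (hg : ∀ i < 6, ∀ t, HasDerivAt (g i) (g (i + 1) t) t) (hg6 : Continuous (g 6))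
    {A B k q : ℝ} (hk : 0 < k) (hq : 0 < q) (h0 : ∀ t, 0 ≤ g 0 t)
    (hineq : ∀ t, k * g 0 t ^ (1 + q) ≤ -(g 6 t - A * g 4 t + B * g 2 t)) (t : ℝ) :
    g 0 t = 0 := by
  have hc : ∀ i ≤ 6, Continuous (g i) := fun i hi => by
    rcases hi.eq_or_lt with rfl | hi
    · exact hg6
    · exact continuous_iff_continuousAt.2 fun t => (hg i hi t).continuousAt
  have cF : Continuous fun x => -(g 6 x - A * g 4 x + B * g 2 x) :=
    ((hg6.sub ((hc 4 (by norm_num)).const_mul A)).add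
      ((hc 2 (by norm_num)).const_mul B)).neg
  obtain ⟨m, D, hD⟩ := exists_integral_mul_scaledBump_le hg hc hk hq h0 hineq
  have hFt := eq_zero_of_integral_mul_scaledBump_le cF (fun t =>
    (mul_nonneg hk.le (Real.rpow_nonneg (h0 t) _)).trans (hineq t)) hD t
  have h1 := (hineq t).trans_eq hFt
  by_contra hne
  have : 0 < g 0 t := lt_of_le_of_ne (h0 t) (Ne.symm hne)
  have : 0 < k * g 0 t ^ (1 + q) := by positivity
  linarith

theorem K0_pos {n : ℕ} (hn : 7 ≤ n) : 0 < K0 n := by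
  have h : (7 : ℝ) ≤ n := by exact_mod_cast hn
  have h6 : 0 < (n : ℝ) - 6 := by linarith
  have h2 : 0 < (n : ℝ) - 2 := by linarith
  unfold K0
  positivity

theorem cN_pos {n : ℕ} (hn : 7 ≤ n) : 0 < cN n := by
  have h : (7 : ℝ) ≤ n := by exact_mod_cast hn
  have h6 : 0 < (n : ℝ) - 6 := by linarith
  have h4 : 0 < (n : ℝ) ^ 2 - 4 := by nlinarith
  have h16 : 0 < (n : ℝ) ^ 2 - 16 := by nlinarith
  have : (n : ℝ) ^ 4 - 20 * (n : ℝ) ^ 2 + 64 = ((n : ℝ) ^ 2 - 4) * ((n : ℝ) ^ 2 - 16) := by ring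
  unfold cN
  rw [this]
  positivity

theorem aStar_pos {n : ℕ} (hn : 7 ≤ n) : 0 < aStar n :=
  Real.rpow_pos_of_pos (div_pos (K0_pos hn) (cN_pos hn)) _

theorem cN_mul_aStar_rpow {n : ℕ} (hn : 7 ≤ n) :
    cN n * aStar n ^ (12 / ((n : ℝ) - 6)) = K0 n := by
  have h : (7 : ℝ) ≤ n := by exact_mod_cast hn
  have h6 : (n : ℝ) - 6 ≠ 0 := by linarith
  have hc := cN_pos hn
  rw [aStar, ← Real.rpow_mul (div_pos (K0_pos hn) hc).le,
    show ((n : ℝ) - 6) / 12 * (12 / ((n : ℝ) - 6)) = 1 by field_simp, Real.rpow_one,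
    mul_div_cancel₀ _ hc.ne']

theorem IsSolO6.neg {n : ℕ} {v : ℝ → ℝ} (hv : IsSolO6 n v) : IsSolO6 n (-v) := by
  refine ⟨hv.1.neg, fun t => ?_⟩
  have := hv.2 t
  simp only [iteratedDeriv_neg, Pi.neg_apply, abs_neg]
  linarith

theorem IsSolO6.eq_aStar_of_le {n : ℕ} (hn : 7 ≤ n) {v : ℝ → ℝ} (hv : IsSolO6 n v)
    (hle : ∀ t, aStar n ≤ v t) : v = fun _ => aStar n := by
  have h : (7 : ℝ) ≤ n := by exact_mod_cast hn
  have h6 : 0 < (n : ℝ) - 6 := by linarith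
  have ha := aStar_pos hn
  have hc := cN_pos hn
  set q := 12 / ((n : ℝ) - 6) with hqdef
  have hq : 0 < q := by positivity
  have hder : ∀ i < 6, ∀ t, HasDerivAt (iteratedDeriv i v) (iteratedDeriv (i + 1) v t) t := by
    intro i hi t
    rw [iteratedDeriv_succ]
    exact (hv.1.differentiable_iteratedDeriv i (by exact_mod_cast hi) t).hasDerivAt
  funext t
  have key := eq_zero_of_sixth_order_inequality
    (g := fun i => if i = 0 then fun t => v t - aStar n else iteratedDeriv i v)
    (A := K4 n) (B := K2 n) (k := cN n * min 1 q) (q := q) ?_ ?_ (by positivity) hq ?_ ?_ t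
  · simpa [sub_eq_zero] using key
  · rintro (_ | i) hi t
    · simpa using (hder 0 hi t).sub_const (aStar n)
    · simpa using hder (i + 1) hi t
  · simpa using hv.1.continuous_iteratedDeriv 6 le_rfl
  · intro t
    simpa using hle t
  · intro t
    have hode := hv.2 t
    have hm := mul_le_mul_of_nonneg_left (min_mul_rpow_sub_le ha (hle t) hq) hc.le
    rw [abs_of_pos (ha.trans_le (hle t)), ← cN_mul_aStar_rpow hn] at hode
    simp only [if_true, OfNat.ofNat_ne_zero, if_false]
    linarith

theorem infimum_estimate_for_O6_solutions
    (n : ℕ) (hn : 7 ≤ n) (v : ℝ → ℝ) (hv : IsSolO6 n v) :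
    (⨅ t : ℝ, |v t|) ≤ aStar n ∧
    ((⨅ t : ℝ, |v t|) = aStar n ↔
      (v = fun _ => aStar n) ∨ (v = fun _ => -aStar n)) := by
  have ha := aStar_pos hn
  have hconst : ((v = fun _ => aStar n) ∨ (v = fun _ => -aStar n)) →
      (⨅ t : ℝ, |v t|) = aStar n := by
    rintro (rfl | rfl) <;> simp [abs_of_pos ha]
  have hrigid : aStar n ≤ (⨅ t : ℝ, |v t|) →
      ((v = fun _ => aStar n) ∨ (v = fun _ => -aStar n)) := by
    intro hinf
    have habs : ∀ t, aStar n ≤ |v t| := fun t =>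
      hinf.trans (ciInf_le ⟨0, by rintro _ ⟨s, rfl⟩; exact abs_nonneg _⟩ t)
    have hne : ∀ t, v t ≠ 0 := fun t h => by
      have := habs t
      rw [h, abs_zero] at this
      linarith
    have hsign : (∀ t, 0 < v t) ∨ ∀ t, v t < 0 := by
      by_contra! hcon
      obtain ⟨⟨s, hs⟩, ⟨u, hu⟩⟩ := hcon
      obtain ⟨w, hw⟩ := mem_range_of_exists_le_of_exists_ge hv.1.continuous ⟨s, hs⟩ ⟨u, hu⟩
      exact hne w hw
    rcases hsign with hpos | hneg
    · exact Or.inl (hv.eq_aStar_of_le hn fun t => by simpa [abs_of_pos (hpos t)] using habs t)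
    · right
      have := hv.neg.eq_aStar_of_le hn fun t => by simpa [abs_of_neg (hneg t)] using habs t
      funext t
      have := congrFun this t
      simp only [Pi.neg_apply] at this
      linarith
  refine ⟨?_, fun h => hrigid h.ge, hconst⟩
  by_contra! hlt
  exact hlt.ne' (hconst (hrigid hlt.le))
end
end
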